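/- arXiv:2007.01562 — 2 statements merged into one kernel-verified Lean document; each statement's English description precedes it below -/
import Mathlib

section
/- Let U be a finite set of still-uncovered elements, let k be a positive integer with k ≤ |U| (the number of elements still required to be covered), and let S_1, …, S_n ⊆ U be finite sets with positive costs G_1, …, G_n such that |S_1 ∪ ⋯ ∪ S_n| ≥ k and Σ_{j=1}^{n} G_j = V. Then there exists an index j with |S_j ∩ U| > 0 such that G_j / min(|S_j ∩ U|, k) ≤ V / k. -/
/-- If finitely many finite sets jointly cover at least `k` elements, then so do their
cardinalities truncated at `k`. -/
theorem le_sum_min_card_of_le_card_biUnion {ι α : Type*} [DecidableEq α]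
    (s : Finset ι) (S : ι → Finset α) (k : ℕ) (hcov : k ≤ (s.biUnion S).card) :
    k ≤ ∑ j ∈ s, min (S j).card k := by
  by_cases h : ∃ j ∈ s, k ≤ (S j).card
  · obtain ⟨j, hj, hkj⟩ := h
    calc k = min (S j).card k := (min_eq_right hkj).symm
      _ ≤ ∑ j ∈ s, min (S j).card k :=
        Finset.single_le_sum (f := fun j => min (S j).card k) (fun _ _ => Nat.zero_le _) hj
  · push Not at h
    calc k ≤ ∑ j ∈ s, (S j).card := hcov.trans Finset.card_biUnion_le
      _ = ∑ j ∈ s, min (S j).card k :=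
        Finset.sum_congr rfl fun j hj => (min_eq_left (h j hj).le).symm

/-- Per-iteration averaging/charging claim in the proof of the greedy approximation
ratio (Theorem 2, Proof B): if the sets `S_1, …, S_n ⊆ U` jointly cover at least `k`
elements and have total cost `V = Σ_j G_j`, then some set `S_j` intersecting `U`
achieves cost-per-needed-covered-element `G_j / min(|S_j ∩ U|, k)` at most `V / k`. -/
theorem greedy_charging_step
    {α : Type*} [DecidableEq α] (U : Finset α) (k : ℕ)
    (hk : 0 < k) (hkU : k ≤ U.card)
    (n : ℕ) (S : Fin n → Finset α) (hS : ∀ j, S j ⊆ U)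
    (G : Fin n → ℝ) (hG : ∀ j, 0 < G j)
    (hcov : k ≤ (Finset.univ.biUnion S).card)
    (V : ℝ) (hV : V = ∑ j, G j) :
    ∃ j : Fin n, 0 < ((S j ∩ U).card) ∧
      G j / (min ((S j ∩ U).card) k : ℝ) ≤ V / (k : ℝ) := by
  have hkR : (0 : ℝ) < k := by exact_mod_cast hk
  have hne : (Finset.univ : Finset (Fin n)).Nonempty := by
    rw [Finset.nonempty_iff_ne_empty]
    intro h
    rw [h, Finset.biUnion_empty, Finset.card_empty] at hcov
    omega
  have hVnonneg : 0 ≤ V := hV ▸ Finset.sum_nonneg fun j _ => (hG j).le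
  have hsum : (k : ℝ) ≤ ∑ j, min ((S j).card : ℝ) k := by
    exact_mod_cast le_sum_min_card_of_le_card_biUnion Finset.univ S k hcov
  simp only [Finset.inter_eq_left.mpr (hS _)]
  by_contra! hcon
  have hlt : ∀ j, V * min ((S j).card : ℝ) k < G j * k := by
    intro j
    rcases Nat.eq_zero_or_pos (S j).card with h0 | hpos
    · simpa [h0, hkR.le] using mul_pos (hG j) hkR
    · have hmin : (0 : ℝ) < min ((S j).card : ℝ) k := lt_min (by exact_mod_cast hpos) hkR
      exact (div_lt_div_iff₀ hkR hmin).mp (hcon j hpos)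
  have hsum_lt := Finset.sum_lt_sum_of_nonempty hne fun j _ => hlt j
  rw [← Finset.mul_sum, ← Finset.sum_mul, ← hV] at hsum_lt
  exact hsum_lt.not_ge (mul_le_mul_of_nonneg_left hsum hVnonneg)
end

section
/- Consider the weighted partial set cover problem: a finite ground set A of grids, subsets A_1, …, A_n ⊆ A with positive costs G_1, …, G_n, and a coverage requirement k = ⌈η·|A|⌉ for some η ∈ (0,1], where a collection of indices J is feasible if |⋃_{j ∈ J} A_j| ≥ k. Suppose a feasible collection of minimum total cost V* exists. Let the greedy algorithm proceed as follows: while fewer than k elements are covered, it selects an unselected set A_j maximizing min(|A_j ∩ (uncovered elements)|, remaining required count) divided by G_j (equivalently, minimizing cost per newly needed covered element), adds it to the solution, and marks its elements covered. Then the total cost of the collection returned by the greedy algorithm is at most F_k · V*, where F_k = Σ_{i=1}^{k} 1/i is the k-th harmonic number. -/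
/-- The elements covered by the sets selected in the list `L`. -/
def greedyCovered {α : Type*} [DecidableEq α] {n : ℕ} (As : Fin n → Finset α)
    (L : List (Fin n)) : Finset α :=
  (L.map As).foldr (· ∪ ·) ∅

/-- The `k`-th harmonic number `F_k = Σ_{i=1}^{k} 1/i`. -/
noncomputable def harmonicNum (k : ℕ) : ℝ :=
  ∑ i ∈ Finset.range k, (1 : ℝ) / (i + 1)

theorem mem_greedyCovered {α : Type*} [DecidableEq α] {n : ℕ} {As : Fin n → Finset α}
    {L : List (Fin n)} {x : α} : x ∈ greedyCovered As L ↔ ∃ j ∈ L, x ∈ As j := by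
  unfold greedyCovered
  induction L with
  | nil => simp
  | cons a L ih => simp [ih]

theorem greedyCovered_take_succ {α : Type*} [DecidableEq α] {n : ℕ} (As : Fin n → Finset α)
    (L : List (Fin n)) (i : ℕ) (hi : i < L.length) :
    greedyCovered As (L.take (i + 1)) = greedyCovered As (L.take i) ∪ As L[i] := by
  ext x
  rw [List.take_succ_eq_append_getElem hi]
  simp only [mem_greedyCovered, Finset.mem_union, List.mem_append, List.mem_singleton]
  constructor
  · rintro ⟨j, hj | rfl, hx⟩
    exacts [.inl ⟨j, hj, hx⟩, .inr hx]
  · rintro (⟨j, hj, hx⟩ | hx)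
    exacts [⟨j, .inl hj, hx⟩, ⟨_, .inr rfl, hx⟩]

theorem harmonicNum_nonneg (k : ℕ) : 0 ≤ harmonicNum k :=
  Finset.sum_nonneg fun _ _ => by positivity

theorem sub_div_le_harmonicNum_sub {a b : ℕ} (hab : a ≤ b) :
    ((b : ℝ) - a) / b ≤ harmonicNum b - harmonicNum a := by
  rw [harmonicNum, harmonicNum, ← Finset.sum_Ico_eq_sub _ hab]
  have h := Finset.card_nsmul_le_sum (Finset.Ico a b) (fun i : ℕ => (1 : ℝ) / (i + 1)) (1 / b)
    fun i hi => by
      have hib : ((i + 1 : ℕ) : ℝ) ≤ b := by exact_mod_cast (Finset.mem_Ico.mp hi).2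
      push_cast at hib
      exact one_div_le_one_div_of_le (by positivity) hib
  rwa [nsmul_eq_mul, Nat.card_Ico, Nat.cast_sub hab, mul_one_div] at h

/-- A feasible collection still meets the remaining demand when each set contributes its number of
uncovered elements truncated at that demand. -/
theorem sub_card_le_sum_min_card_sdiff {ι α : Type*} [DecidableEq α] (As : ι → Finset α)
    (J : Finset ι) (C : Finset α) {k : ℕ} (hJ : k ≤ (J.biUnion As).card) :
    k - C.card ≤ ∑ j ∈ J, min (As j \ C).card (k - C.card) := by
  by_cases h : ∃ j ∈ J, k - C.card ≤ (As j \ C).card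
  · obtain ⟨j, hj, hle⟩ := h
    calc k - C.card = min (As j \ C).card (k - C.card) := (min_eq_right hle).symm
      _ ≤ _ := Finset.single_le_sum (f := fun j => min (As j \ C).card (k - C.card))
        (fun _ _ => Nat.zero_le _) hj
  · push Not at h
    rw [Finset.sum_congr rfl fun j hj => min_eq_left (h j hj).le]
    calc k - C.card ≤ (J.biUnion As).card - C.card := Nat.sub_le_sub_right hJ _
      _ ≤ (J.biUnion As \ C).card := Finset.le_card_sdiff _ _
      _ = (J.biUnion fun j => As j \ C).card := by
        congr 1
        ext x
        simp only [Finset.mem_sdiff, Finset.mem_biUnion]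
        tauto
      _ ≤ _ := Finset.card_biUnion_le

/-- The cost of a greedy choice is at most the optimal cost times the fraction of the remaining
demand that the choice meets. -/
theorem greedy_choice_cost_le {ι α : Type*} [DecidableEq α] (As : ι → Finset α)
    (G : ι → ℝ) (hG : ∀ j, 0 < G j) (J : Finset ι) (C : Finset α) {k : ℕ}
    (hJ : k ≤ (J.biUnion As).card) (hC : C.card < k) (p : ι)
    (hp : ∀ j, ¬ As j ⊆ C →
      (min (As j \ C).card (k - C.card) : ℕ) / G j ≤
        ((min (As p \ C).card (k - C.card) : ℕ) : ℝ) / G p) :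
    G p ≤ (∑ j ∈ J, G j) * ((min (As p \ C).card (k - C.card) : ℕ) / (k - C.card : ℕ)) := by
  have hr : (0 : ℝ) < (k - C.card : ℕ) := by exact_mod_cast Nat.sub_pos_of_lt hC
  set m : ι → ℕ := fun j => min (As j \ C).card (k - C.card) with hm
  have hle : ∀ j, (m j : ℝ) ≤ m p / G p * G j := fun j => by
    by_cases hj : As j ⊆ C
    · have h0 : m j = 0 := by simp [hm, Finset.sdiff_eq_empty_iff_subset.mpr hj]
      rw [h0, Nat.cast_zero]
      have := hG p
      have := hG j
      positivity
    · exact (div_le_iff₀ (hG j)).mp (hp j hj)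
  have hsum : ((k - C.card : ℕ) : ℝ) ≤ m p / G p * ∑ j ∈ J, G j := by
    calc ((k - C.card : ℕ) : ℝ) ≤ ∑ j ∈ J, (m j : ℝ) := by
          exact_mod_cast sub_card_le_sum_min_card_sdiff As J C hJ
      _ ≤ ∑ j ∈ J, m p / G p * G j := Finset.sum_le_sum fun j _ => hle j
      _ = _ := by rw [Finset.mul_sum]
  rw [div_mul_eq_mul_div, le_div_iff₀ (hG p)] at hsum
  rw [← mul_div_assoc, le_div_iff₀ hr]
  change G p * _ ≤ _ * (m p : ℝ)
  linarith

/-- Theorem 2: the greedy algorithm for weighted partial set cover (Algorithm 1,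
cost-aware photo selection) achieves approximation ratio `F_k`, `k = ⌈η·|A|⌉`.
`L` is the sequence of indices selected by the greedy algorithm: at each step the
coverage is still below `k`, and the chosen set maximizes
`min(|A_j ∩ uncovered|, remaining required count) / G_j` among unselected sets;
when the algorithm stops at least `k` elements are covered.  Its total cost is at
most `F_k · V*`, where `V*` is the minimum cost of a feasible collection. -/
theorem greedy_partial_set_cover_approximation
    {α : Type*} [DecidableEq α] {n : ℕ}
    (A : Finset α) (As : Fin n → Finset α) (hAs : ∀ j, As j ⊆ A)
    (G : Fin n → ℝ) (hG : ∀ j, 0 < G j)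
    (η : ℝ) (hη0 : 0 < η) (hη1 : η ≤ 1)
    (k : ℕ) (hk : k = ⌈η * (A.card : ℝ)⌉₊)
    (Vstar : ℝ)
    (hVstar : IsLeast { c : ℝ | ∃ J : Finset (Fin n),
        k ≤ (J.biUnion As).card ∧ c = ∑ j ∈ J, G j } Vstar)
    (L : List (Fin n)) (hnodup : L.Nodup)
    (hstep : ∀ i : Fin L.length,
      (greedyCovered As (L.take i)).card < k ∧
      ∀ j : Fin n, j ∉ L.take i →
        ((min ((As j \ greedyCovered As (L.take i)).card)
              (k - (greedyCovered As (L.take i)).card) : ℝ) / G j ≤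
         (min ((As (L.get i) \ greedyCovered As (L.take i)).card)
              (k - (greedyCovered As (L.take i)).card) : ℝ) / G (L.get i)))
    (hdone : k ≤ (greedyCovered As L).card) :
    ∑ j ∈ L.toFinset, G j ≤ harmonicNum k * Vstar := by
  obtain ⟨⟨J, hJ, hV⟩, -⟩ := hVstar
  have hV0 : 0 ≤ Vstar := hV ▸ Finset.sum_nonneg fun j _ => (hG j).le
  have key : ∀ i ≤ L.length, ((L.take i).map G).sum ≤
      Vstar * (harmonicNum k - harmonicNum (k - (greedyCovered As (L.take i)).card)) := by
    intro i
    induction i with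
    | zero => simp [greedyCovered]
    | succ i ih =>
      intro hi
      have ih := ih (by omega)
      obtain ⟨hlt, hmax⟩ := hstep ⟨i, hi⟩
      simp only [List.get_eq_getElem] at hlt hmax
      rw [greedyCovered_take_succ As L i hi, List.take_succ_eq_append_getElem hi]
      set C := greedyCovered As (L.take i)
      have hcost := greedy_choice_cost_le As G hG J C hJ hlt L[i] fun j hj => by
        have := hmax j fun hmem => hj fun x hx => mem_greedyCovered.mpr ⟨j, hmem, hx⟩
        push_cast [Nat.cast_sub hlt.le]
        exact this
      have hcard : (C ∪ As L[i]).card = C.card + (As L[i] \ C).card := by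
        rw [← Finset.union_sdiff_self_eq_union, Finset.card_union_of_disjoint Finset.disjoint_sdiff]
      have hab : k - (C ∪ As L[i]).card ≤ k - C.card := by omega
      have hH := sub_div_le_harmonicNum_sub hab
      have hmin : min (As L[i] \ C).card (k - C.card) =
          (k - C.card) - (k - (C ∪ As L[i]).card) := by omega
      rw [← Nat.cast_sub hab, ← hmin] at hH
      have hmul := mul_le_mul_of_nonneg_left hH hV0
      rw [← hV] at hcost
      rw [List.map_append, List.sum_append, List.map_singleton, List.sum_singleton]
      linarith
  have htotal := key L.length le_rfl
  rw [List.take_length] at htotal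
  rw [List.sum_toFinset G hnodup]
  nlinarith [mul_nonneg hV0 (harmonicNum_nonneg (k - (greedyCovered As L).card))]
end
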